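/- Every virtual knot K is related to the trivial knot O by a finite sequence of crossing changes (2-moves) and Ξ-moves. -/

import Mathlib

/-!
Combinatorial Gauss diagrams.

A Gauss diagram is encoded as a list of chord endpoints read along the
oriented circle from a basepoint.  Each endpoint records the (natural number)
label of its chord, whether it is the terminal endpoint of the (oriented)
chord, and the sign of the chord (`true` = +1, `false` = -1).
Diagrams are considered up to rotation of the basepoint and relabeling of the
chords; these renamings are included among the "Reidemeister" generators.
-/

structure Endpoint where
  label : ℕ
  isTerminal : Bool
  sign : Bool
deriving DecidableEq

namespace Gauss

/-- The sign (±1) of the chord through an endpoint. -/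
def signValue (e : Endpoint) : ℤ := if e.sign then 1 else -1

/-- The sign assigned to an endpoint: `ε` at the terminal endpoint and `-ε`
at the initial endpoint of a chord of sign `ε`. -/
def endpointValue (e : Endpoint) : ℤ := if e.isTerminal then signValue e else -signValue e

/-- The list of chord labels of the endpoints of a word. -/
def labels (L : List Endpoint) : List ℕ := L.map Endpoint.label

/-- A word is a Gauss diagram when every chord label occurring in it occurs
exactly twice, once as an initial and once as a terminal endpoint, with the
same sign at both occurrences. -/
def IsGaussDiagram (L : List Endpoint) : Prop :=
  ∀ e ∈ L, (L.filter (fun x => x.label == e.label)).length = 2 ∧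
    ∃ e' ∈ L, e'.label = e.label ∧ e'.isTerminal = !e.isTerminal ∧ e'.sign = e.sign

/-- Rotate a word so that the first endpoint satisfying `p` comes first. -/
def rotateTo (L : List Endpoint) (p : Endpoint → Bool) : List Endpoint :=
  match L.findIdx? p with
  | some i => L.drop i ++ L.take i
  | none => L

/-- The index of the chord labeled `c`: the sum of the signs assigned to the
endpoints on the arc running from the initial endpoint of the chord to its
terminal endpoint in the direction of the circle's orientation. -/
def chordIndex (L : List Endpoint) (c : ℕ) : ℤ :=
  ((((rotateTo L (fun e => e.label == c && !e.isTerminal)).drop 1).takeWhile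
      (fun e => e.label != c)).map endpointValue).sum

/-- `Jn L n`: the sum of the signs of the chords of `L` of index `n`. -/
def Jn (L : List Endpoint) (n : ℤ) : ℤ :=
  ((L.filter (fun e => e.isTerminal && decide (chordIndex L e.label = n))).map signValue).sum

/-- The odd writhe: the sum of the signs of the chords of odd index,
i.e. `J = Σ_{n odd} J_n`. -/
def oddWrithe (L : List Endpoint) : ℤ :=
  ((L.filter (fun e => e.isTerminal && decide (chordIndex L e.label % 2 ≠ 0))).map signValue).sum

/-- Moving the basepoint of the circle. -/
def rotateStep (L L' : List Endpoint) : Prop :=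
  ∃ x xs, L = x :: xs ∧ L' = xs ++ [x]

/-- Injective relabeling of the chords. -/
def relabelStep (L L' : List Endpoint) : Prop :=
  ∃ f : ℕ → ℕ, Function.Injective f ∧
    L' = L.map (fun e => Endpoint.mk (f e.label) e.isTerminal e.sign)

/-- Reidemeister move I (removal direction): remove an isolated chord whose
two endpoints are adjacent (either orientation, either sign). -/
def reid1 (L L' : List Endpoint) : Prop :=
  ∃ (A B : List Endpoint) (c : ℕ) (t s : Bool),
    c ∉ labels (A ++ B) ∧
    L = A ++ [Endpoint.mk c t s, Endpoint.mk c (!t) s] ++ B ∧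
    L' = A ++ B

/-- Reidemeister move II (removal direction): remove two chords of opposite
signs whose initial endpoints are adjacent and whose terminal endpoints are
adjacent (in either of the two admissible orders). -/
def reid2 (L L' : List Endpoint) : Prop :=
  ∃ (A B C : List Endpoint) (c d : ℕ) (s crossed : Bool),
    c ≠ d ∧ c ∉ labels (A ++ B ++ C) ∧ d ∉ labels (A ++ B ++ C) ∧
    L = A ++ [Endpoint.mk c false s, Endpoint.mk d false (!s)] ++ B ++
        (if crossed then [Endpoint.mk c true s, Endpoint.mk d true (!s)]
         else [Endpoint.mk d true (!s), Endpoint.mk c true s]) ++ C ∧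
    L' = A ++ B ++ C

/-- Reidemeister move III (a standard variant; together with the moves I, II,
rotations and relabelings it generates all versions of the third move). -/
def reid3 (L L' : List Endpoint) : Prop :=
  ∃ (A B C D : List Endpoint) (a b c : ℕ) (s : Bool),
    a ≠ b ∧ b ≠ c ∧ a ≠ c ∧
    L = A ++ [Endpoint.mk b false s, Endpoint.mk a false s] ++ B ++
        [Endpoint.mk a true s, Endpoint.mk c false (!s)] ++ C ++
        [Endpoint.mk b true s, Endpoint.mk c true (!s)] ++ D ∧
    L' = A ++ [Endpoint.mk a false s, Endpoint.mk b false s] ++ B ++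
        [Endpoint.mk c false (!s), Endpoint.mk a true s] ++ C ++
        [Endpoint.mk c true (!s), Endpoint.mk b true s] ++ D

/-- A single Reidemeister generator (including diagram renamings). -/
def reidStep (L L' : List Endpoint) : Prop :=
  rotateStep L L' ∨ relabelStep L L' ∨ reid1 L L' ∨ reid2 L L' ∨ reid3 L L'

/-- A Ξ-move: exchange the first and third of three consecutive endpoints
belonging to three distinct chords, keeping all signs and orientations. -/
def xiStep (L L' : List Endpoint) : Prop :=
  ∃ (A B : List Endpoint) (x y z : Endpoint),
    x.label ≠ y.label ∧ y.label ≠ z.label ∧ x.label ≠ z.label ∧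
    L = A ++ [x, y, z] ++ B ∧
    L' = A ++ [z, y, x] ++ B

/-- A 2k-move (removal direction): remove `2k` chords `c 0, …, c (2k-1)`, all
of sign `s`, whose `p`-endpoints appear consecutively on one arc and whose
`q`-endpoints appear consecutively on a disjoint arc, the chord `c i` being
oriented from `p` to `q` for even `i` (the paper's odd `i`, 1-indexed) and
from `q` to `p` for odd `i`, so initial and terminal endpoints alternate. -/
def move2k (k : ℕ) (L L' : List Endpoint) : Prop :=
  ∃ (A B C : List Endpoint) (c : ℕ → ℕ) (s : Bool),
    (∀ i < 2 * k, ∀ j < 2 * k, c i = c j → i = j) ∧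
    (∀ i < 2 * k, c i ∉ labels (A ++ B ++ C)) ∧
    L = A ++ (List.range (2 * k)).map (fun i => Endpoint.mk (c i) (decide (i % 2 = 1)) s)
          ++ B ++
        (List.range (2 * k)).map (fun i => Endpoint.mk (c i) (decide (i % 2 = 0)) s)
          ++ C ∧
    L' = A ++ B ++ C

/-- A crossing change: reverse the sign and the orientation of one chord. -/
def crossingChange (L L' : List Endpoint) : Prop :=
  ∃ c : ℕ,
    L' = L.map (fun e =>
      if e.label = c then Endpoint.mk e.label (!e.isTerminal) (!e.sign) else e)

/-- Finite sequences of moves from `r`, performed in either direction. -/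
def Moves (r : List Endpoint → List Endpoint → Prop) :
    List Endpoint → List Endpoint → Prop :=
  Relation.ReflTransGen (fun L L' => r L L' ∨ r L' L)

/-- Related by Reidemeister moves: the two words represent the same virtual knot. -/
def ReidEquiv : List Endpoint → List Endpoint → Prop := Moves reidStep

/-- Related by a finite sequence of 2k-moves (and Reidemeister moves). -/
def Rel2k (k : ℕ) : List Endpoint → List Endpoint → Prop :=
  Moves (fun L L' => reidStep L L' ∨ move2k k L L')

/-- Related by a finite sequence of Ξ-moves (and Reidemeister moves). -/
def RelXi : List Endpoint → List Endpoint → Prop :=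
  Moves (fun L L' => reidStep L L' ∨ xiStep L L')

/-- Related by a finite sequence of 2k-moves and Ξ-moves (and Reidemeister moves). -/
def Rel2kXi (k : ℕ) : List Endpoint → List Endpoint → Prop :=
  Moves (fun L L' => reidStep L L' ∨ move2k k L L' ∨ xiStep L L')

/-- Related by a finite sequence of crossing changes and Ξ-moves
(and Reidemeister moves). -/
def RelCCXi : List Endpoint → List Endpoint → Prop :=
  Moves (fun L L' => reidStep L L' ∨ crossingChange L L' ∨ xiStep L L')

/-- A shell-pair of sign `s`: two chords `c`, `d` of sign `s` whose four
endpoints are consecutive, interleaved as 1st-3rd and 2nd-4th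
(with arbitrary orientations `t`, `u` of the two shells). -/
def shellPair (c d : ℕ) (t u s : Bool) : List Endpoint :=
  [Endpoint.mk c t s, Endpoint.mk d u s, Endpoint.mk c (!t) s, Endpoint.mk d (!u) s]

/-- The Gauss diagram `G(a)`: `|a|` consecutive shell-pairs of sign `+1` if
`a > 0` and of sign `-1` if `a < 0`; `G(0)` has no chords.  It represents the
virtual knot `K(a)`. -/
def Gword (a : ℤ) : List Endpoint :=
  ((List.range a.natAbs).map
    (fun j => shellPair (2 * j) (2 * j + 1) false false (decide (0 < a)))).flatten

/-- `Rel2kCount k m G G'`: `G` and `G'` are related by a finite sequence of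
Reidemeister moves and exactly `m` 2k-moves. -/
inductive Rel2kCount (k : ℕ) : ℕ → List Endpoint → List Endpoint → Prop
  | refl (L : List Endpoint) : Rel2kCount k 0 L L
  | reid {m : ℕ} {L L' L'' : List Endpoint} :
      reidStep L L' ∨ reidStep L' L →
      Rel2kCount k m L' L'' → Rel2kCount k m L L''
  | move {m : ℕ} {L L' L'' : List Endpoint} :
      move2k k L L' ∨ move2k k L' L →
      Rel2kCount k m L' L'' → Rel2kCount k (m + 1) L L''

/-- The 2k-move distance: the minimal number of 2k-moves needed to relate the
two diagrams (together with Reidemeister moves). -/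
noncomputable def dist2k (k : ℕ) (L L' : List Endpoint) : ℕ :=
  sInf {m | Rel2kCount k m L L'}

end Gauss


namespace Gauss

theorem gauss_perm {L L' : List Endpoint} (h : L.Perm L') (hL : IsGaussDiagram L) :
    IsGaussDiagram L' := by
  intro e he
  obtain ⟨h1, e', he', h2⟩ := hL e (h.mem_iff.mpr he)
  refine ⟨?_, e', h.mem_iff.mp he', h2⟩
  rw [← h1]
  exact ((h.filter _).length_eq).symm

/-- Two endpoints with the same label, in front of a Gauss diagram. -/
theorem gauss_pair {x y : Endpoint} {T : List Endpoint} (hL : IsGaussDiagram (x :: y :: T))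
    (hxy : x.label = y.label) :
    (∀ e ∈ T, e.label ≠ x.label) ∧ y = Endpoint.mk x.label (!x.isTerminal) x.sign ∧
      IsGaussDiagram T := by
  obtain ⟨h1, e', he', h2, h3, h4⟩ := hL x (by simp)
  have hT : ∀ e ∈ T, e.label ≠ x.label := by
    intro e he hex
    have hm : e ∈ T.filter (fun z => z.label == x.label) := by
      simp [he, hex]
    have := List.length_pos_of_mem hm
    simp [← hxy] at h1
    exact h1 e he hex
  refine ⟨hT, ?_, ?_⟩
  · rcases List.mem_cons.mp he' with rfl | he'
    · simp at h3
    rcases List.mem_cons.mp he' with rfl | he'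
    · cases e'; simp_all
    · exact absurd h2 (hT _ he')
  · intro e he
    obtain ⟨k1, f, hf, k2, k3⟩ := hL e (by simp [he])
    have hne := hT e he
    refine ⟨?_, f, ?_, k2, k3⟩
    · rw [← k1, List.filter_cons_of_neg, List.filter_cons_of_neg]
      · simpa [← hxy] using fun h => hne h.symm
      · simpa using fun h => hne h.symm
    · rcases List.mem_cons.mp hf with rfl | hf
      · exact absurd k2.symm hne
      rcases List.mem_cons.mp hf with rfl | hf
      · exact absurd (k2.symm.trans hxy.symm) hne
      · exact hf

theorem gauss_partner {x : Endpoint} {R : List Endpoint} (hL : IsGaussDiagram (x :: R)) :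
    ∃ P y Q, R = P ++ y :: Q ∧ y.label = x.label := by
  obtain ⟨-, e', he', h2, h3, h4⟩ := hL x (by simp)
  rcases List.mem_cons.mp he' with rfl | he'
  · simp at h3
  · obtain ⟨P, Q, rfl⟩ := List.append_of_mem he'
    exact ⟨P, e', Q, rfl, h2⟩

abbrev Triv (L : List Endpoint) : Prop := RelCCXi L []

theorem triv_step {L L' : List Endpoint}
    (h : reidStep L L' ∨ crossingChange L L' ∨ xiStep L L') (h' : Triv L') : Triv L :=
  Relation.ReflTransGen.head (Or.inl h) h'

theorem triv_rot {x : Endpoint} {xs : List Endpoint} (h : Triv (xs ++ [x])) : Triv (x :: xs) :=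
  triv_step (Or.inl (Or.inl ⟨x, xs, rfl, rfl⟩)) h

theorem triv_xi (A B : List Endpoint) {x y z : Endpoint} (h1 : x.label ≠ y.label)
    (h2 : y.label ≠ z.label) (h3 : x.label ≠ z.label) (h : Triv (A ++ z :: y :: x :: B)) :
    Triv (A ++ x :: y :: z :: B) :=
  triv_step (Or.inr (Or.inr ⟨A, B, x, y, z, h1, h2, h3, by simp, rfl⟩)) (by simpa using h)

def IH (n : ℕ) : Prop := ∀ L : List Endpoint, L.length < n → IsGaussDiagram L → Triv L

theorem triv_r1 {n : ℕ} (ih : IH n) (A B : List Endpoint) {x y : Endpoint}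
    (hG : IsGaussDiagram (A ++ x :: y :: B)) (hn : (A ++ x :: y :: B).length = n)
    (hxy : x.label = y.label) : Triv (A ++ x :: y :: B) := by
  have hp : (A ++ x :: y :: B).Perm (x :: y :: (A ++ B)) :=
    List.perm_middle.trans (List.Perm.cons _ List.perm_middle)
  obtain ⟨h1, h2, h3⟩ := gauss_pair (gauss_perm hp hG) hxy
  refine triv_step (L' := A ++ B) (Or.inl (Or.inr (Or.inr (Or.inl
    ⟨A, B, x.label, x.isTerminal, x.sign, ?_, ?_, rfl⟩)))) (ih _ ?_ h3)
  · intro hm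
    obtain ⟨e, he, hx⟩ := List.mem_map.mp hm
    exact h1 e he hx
  · rw [h2]; simp
  · simp at hn ⊢; omega

theorem slide {n : ℕ} (ih : IH n) : ∀ (k : ℕ) (U A : List Endpoint) (c : Endpoint)
    (B : List Endpoint), U.length = 2 * k → (∀ u ∈ U, u.label ≠ c.label) →
    IsGaussDiagram (A ++ (U ++ c :: B)) → (A ++ (U ++ c :: B)).length = n →
    (∀ U' : List Endpoint, U'.Perm U → Triv (A ++ c :: (U' ++ B))) →
    Triv (A ++ (U ++ c :: B)) := by
  intro k
  induction k with
  | zero =>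
    intro U A c B hU _ _ _ h
    have : U = [] := List.length_eq_zero_iff.mp (by simpa using hU)
    subst this
    simpa using h [] (List.Perm.refl _)
  | succ k ihk =>
    intro U A c B hU hc hG hn h
    match U, hU with
    | u :: v :: U1, hU =>
      by_cases huv : u.label = v.label
      · exact triv_r1 ih A (U1 ++ c :: B) hG hn huv
      have := ihk U1 (A ++ [u, v]) c B (by simp at hU; omega)
        (fun w hw => hc w (by simp [hw])) (by simpa using hG) (by simpa using hn) ?_
      · simpa using this
      intro U1' hp
      have h2 := h (v :: u :: U1')
        ((List.Perm.swap _ _ _).trans ((hp.cons _).cons _))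
      have := triv_xi A (U1' ++ B) huv (hc v (by simp)) (hc u (by simp)) (by simpa using h2)
      simpa using this

/-- Normalise by a crossing change. -/
theorem triv_cc (c : ℕ) {L : List Endpoint}
    (h : Triv (L.map (fun e =>
      if e.label = c then Endpoint.mk e.label (!e.isTerminal) (!e.sign) else e))) : Triv L :=
  triv_step (Or.inr (Or.inl ⟨c, rfl⟩)) h

theorem map_fix (c : ℕ) (T : List Endpoint) (h : ∀ e ∈ T, e.label ≠ c) :
    T.map (fun e =>
      if e.label = c then Endpoint.mk e.label (!e.isTerminal) (!e.sign) else e) = T := by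
  conv_rhs => rw [← List.map_id T]
  apply List.map_congr_left
  intro e he
  simp [h e he]

theorem triv_r2_core {c d : ℕ} (hcd : c ≠ d) {t s u r : Bool} {T : List Endpoint}
    (hc : ∀ e ∈ T, e.label ≠ c) (hd : ∀ e ∈ T, e.label ≠ d) (hT : Triv T)
    (hv : (t ^^ s) ≠ (u ^^ r)) :
    Triv (⟨c, t, s⟩ :: ⟨d, u, r⟩ :: ⟨c, !t, s⟩ :: ⟨d, !u, r⟩ :: T) := by
  have base : ∀ s, Triv (⟨c, false, s⟩ :: ⟨d, false, !s⟩ :: ⟨c, true, s⟩ ::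
      ⟨d, true, !s⟩ :: T) := by
    intro s
    refine triv_step (L' := T) (Or.inl (Or.inr (Or.inr (Or.inr (Or.inl
      ⟨[], [], T, c, d, s, true, hcd, ?_, ?_, by simp, by simp⟩))))) hT
    · intro hm
      obtain ⟨e, he, hx⟩ := List.mem_map.mp hm
      exact hc e (by simpa using he) hx
    · intro hm
      obtain ⟨e, he, hx⟩ := List.mem_map.mp hm
      exact hd e (by simpa using he) hx
  have step1 : ∀ t s r, (t ^^ s) ≠ r →
      Triv (⟨c, t, s⟩ :: ⟨d, false, r⟩ :: ⟨c, !t, s⟩ :: ⟨d, true, r⟩ :: T) := by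
    intro t s r h
    cases t
    · have : r = !s := by cases s <;> cases r <;> simp_all
      subst this
      exact base s
    · apply triv_cc c
      have : r = s := by cases s <;> cases r <;> simp_all
      subst this
      have := base (!r)
      simpa [map_fix c T hc, hcd.symm] using this
  cases u
  · exact step1 t s r (by simpa using hv)
  · apply triv_cc d
    have := step1 t s (!r) (by simpa using hv)
    simpa [map_fix d T hd, hcd] using this

theorem triv_r2 {n : ℕ} (ih : IH n) {c d c' d' : Endpoint} {T : List Endpoint}
    (hG : IsGaussDiagram (c :: d :: c' :: d' :: T)) (hn : (c :: d :: c' :: d' :: T).length = n)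
    (h1 : c.label = c'.label) (h2 : d.label = d'.label)
    (hv : (c.isTerminal ^^ c.sign) ≠ (d.isTerminal ^^ d.sign)) :
    Triv (c :: d :: c' :: d' :: T) := by
  have hp : (c :: d :: c' :: d' :: T).Perm (c :: c' :: d :: d' :: T) :=
    (List.Perm.swap _ _ _).cons _
  obtain ⟨a1, a2, a3⟩ := gauss_pair (gauss_perm hp hG) h1
  obtain ⟨b1, b2, b3⟩ := gauss_pair a3 h2
  have := triv_r2_core (c := c.label) (d := d.label) (t := c.isTerminal) (s := c.sign)
    (u := d.isTerminal) (r := d.sign) (T := T) (fun h => a1 d (by simp) h.symm)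
    (fun e he => a1 e (by simp [he])) b1 (ih T (by simp at hn; omega) b3) hv
  rw [a2, b2]
  exact this

/-- The shell pair can be removed. -/
theorem triv_shell {n : ℕ} (ih : IH n) {c d c' d' : Endpoint} {T : List Endpoint}
    (hG : IsGaussDiagram (c :: d :: c' :: d' :: T)) (hn : (c :: d :: c' :: d' :: T).length = n)
    (h1 : c.label = c'.label) (h2 : d.label = d'.label) :
    Triv (c :: d :: c' :: d' :: T) := by
  by_cases hv : (c.isTerminal ^^ c.sign) ≠ (d.isTerminal ^^ d.sign)
  · exact triv_r2 ih hG hn h1 h2 hv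
  have hp : (c :: d :: c' :: d' :: T).Perm (c :: c' :: d :: d' :: T) :=
    (List.Perm.swap _ _ _).cons _
  obtain ⟨a1, a2, a3⟩ := gauss_pair (gauss_perm hp hG) h1
  obtain ⟨b1, b2, b3⟩ := gauss_pair a3 h2
  apply triv_rot
  have hrot : (c :: d :: c' :: d' :: T).Perm (d :: c' :: d' :: T ++ [c]) :=
    (List.perm_append_singleton _ _).symm
  have hdc : d.label ≠ c.label := a1 d (by simp)
  rcases Nat.even_or_odd' T.length with ⟨k, hk | hk⟩
  · have := slide ih k T [d, c', d'] c [] hk (fun u hu => a1 u (by simp [hu]))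
      (gauss_perm (by simpa using hrot) hG)
      (by rw [← hn]; simp) ?_
    · simpa using this
    intro U' hU'
    have hp2 : (c :: d :: c' :: d' :: T).Perm (d :: c' :: d' :: c :: U') := by
      refine hrot.trans ?_
      refine List.Perm.cons _ (List.Perm.cons _ (List.Perm.cons _ ?_))
      exact (List.perm_append_singleton _ _).trans (hU'.symm.cons _)
    have := triv_r2 ih (gauss_perm hp2 hG) (by rw [← hn]; exact hp2.length_eq.symm) h2 h1.symm ?_
    · simpa using this
    · rw [a2]; intro h; apply hv; intro h'; rw [← h'] at h; revert h; simp
  · match T, hk with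
    | t :: T1, hk =>
      have := slide ih k T1 [d, c', d', t] c [] (by simpa using hk)
        (fun u hu => a1 u (by simp [hu]))
        (gauss_perm (by simpa using hrot) hG)
        (by rw [← hn]; simp) ?_
      · simpa using this
      intro U' hU'
      have hp2 : (c :: d :: c' :: d' :: t :: T1).Perm ([d] ++ c' :: c :: t :: d' :: U') := by
        rw [List.perm_iff_count]
        intro a
        have := hU'.count_eq a
        simp [List.count_cons, this]
        omega
      have := triv_xi [d, c'] U' (x := d') (y := t) (z := c)
        (fun h => b1 t (by simp) (h2 ▸ h.symm)) (a1 t (by simp)) (by rw [← h2]; exact hdc)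
        (triv_r1 ih [d] (t :: d' :: U') (gauss_perm hp2 hG)
          (by rw [← hn]; exact hp2.length_eq.symm) h1.symm)
      simpa using this

theorem main_step {n : ℕ} (ih : IH n) (L : List Endpoint) (hn : L.length = n)
    (hG : IsGaussDiagram L) : Triv L := by
  match L, hn, hG with
  | [], _, _ => exact Relation.ReflTransGen.refl
  | c :: R, hn, hG =>
    obtain ⟨W, c', V, rfl, hcc⟩ := gauss_partner hG
    have hp : (c :: (W ++ c' :: V)).Perm (c :: c' :: (W ++ V)) :=
      List.perm_middle.cons _
    obtain ⟨a1, a2, a3⟩ := gauss_pair (gauss_perm hp hG) hcc.symm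
    rcases Nat.even_or_odd' W.length with ⟨k, hk | hk⟩
    · refine slide ih k W [c] c' V hk (fun u hu => hcc ▸ a1 u (by simp [hu])) hG hn ?_
      intro U' hU'
      have hp2 : (c :: (W ++ c' :: V)).Perm (c :: c' :: (U' ++ V)) :=
        hp.trans (((hU'.symm.append_right V).cons _).cons _)
      exact triv_r1 ih [] (U' ++ V) (gauss_perm hp2 hG)
        (by rw [← hn]; exact hp2.length_eq.symm) hcc.symm
    · match W, hk with
      | d :: W1, hk =>
      refine slide ih k W1 [c, d] c' V (by simpa using hk)
        (fun u hu => hcc ▸ a1 u (by simp [hu])) hG hn ?_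
      intro U' hU'
      have hp2 : (c :: (d :: W1 ++ c' :: V)).Perm (c :: c' :: d :: (U' ++ V)) :=
        hp.trans ((((hU'.symm.append_right V).cons _).cons _).cons _)
      obtain ⟨x1, x2, x3⟩ := gauss_pair (gauss_perm hp2 hG) hcc.symm
      obtain ⟨P, d', Q, hPQ, hdd⟩ := gauss_partner x3
      rw [hPQ] at hp2 x1 x3 ⊢
      have hp3 : (c :: (d :: W1 ++ c' :: V)).Perm (c :: d :: c' :: (P ++ d' :: Q)) :=
        hp2.trans ((List.Perm.swap _ _ _).cons _)
      have hp4 : (d :: (P ++ d' :: Q)).Perm (d :: d' :: (P ++ Q)) :=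
        List.perm_middle.cons _
      obtain ⟨y1, y2, y3⟩ := gauss_pair (gauss_perm hp4 x3) hdd.symm
      rcases Nat.even_or_odd' P.length with ⟨j, hj | hj⟩
      · refine slide ih j P [c, d, c'] d' Q hj (fun u hu => hdd ▸ y1 u (by simp [hu]))
          (gauss_perm hp3 hG) (by rw [← hn]; exact hp3.length_eq.symm) ?_
        intro P' hP'
        have hp5 : (c :: (d :: W1 ++ c' :: V)).Perm (c :: d :: c' :: d' :: (P' ++ Q)) :=
          hp3.trans (((List.perm_middle.trans
            ((hP'.symm.append_right Q).cons _)).cons _).cons _ |>.cons _)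
        exact triv_shell ih (gauss_perm hp5 hG) (by rw [← hn]; exact hp5.length_eq.symm)
          hcc.symm hdd.symm
      · match P, hj with
        | p :: P1, hj =>
        refine slide ih j P1 [c, d, c', p] d' Q (by simpa using hj)
          (fun u hu => hdd ▸ y1 u (by simp [hu]))
          (gauss_perm hp3 hG) (by rw [← hn]; exact hp3.length_eq.symm) ?_
        intro P' hP'
        have hp5 : (c :: (d :: W1 ++ c' :: V)).Perm
            ([c] ++ d :: d' :: p :: c' :: (P' ++ Q)) := by
          refine hp3.trans ?_
          rw [List.perm_iff_count]
          intro a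
          have := hP'.count_eq a
          simp [List.count_cons, this]
          omega
        exact triv_xi [c, d] (P' ++ Q) (x := c') (y := p) (z := d')
          (fun h => x1 p (by simp) (hcc ▸ h.symm))
          (fun h => y1 p (by simp) (hdd ▸ h))
          (fun h => x1 d' (by simp) (hcc ▸ h.symm))
          (triv_r1 ih [c] (p :: c' :: (P' ++ Q)) (gauss_perm hp5 hG)
            (by rw [← hn]; exact hp5.length_eq.symm) hdd.symm)

theorem all_ih (n : ℕ) : IH n := by
  induction n with
  | zero => intro L h; omega
  | succ n ih =>
    intro L h hG
    rcases Nat.lt_succ_iff_lt_or_eq.mp h with h | h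
    · exact ih L h hG
    · exact main_step ih L h hG

end Gauss

open Gauss in
/-- every virtual knot is related to the trivial knot (the
chordless Gauss diagram) by a finite sequence of crossing changes and Ξ-moves
(and Reidemeister moves). -/
theorem relCCXi_unknotting (G : List Endpoint) (hG : IsGaussDiagram G) :
    RelCCXi G [] := by
  exact all_ih (G.length + 1) G (Nat.lt_succ_self _) hG
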